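/- If μ is a T-invariant probability measure on M with periodic repetitive pattern, then its measure-theoretic (Kolmogorov–Sinai) entropy satisfies h_μ(T) = 0. -/

import Mathlib

open MeasureTheory Filter Set
open scoped ENNReal NNReal

noncomputable section

/-- The two-sided full shift space on `k` symbols. -/
abbrev Shift (k : ℕ) := ℤ → Fin k

/-- The shift map `σ`. -/
def shiftMap (k : ℕ) : Shift k → Shift k := fun ξ i => ξ (i + 1)

/-- The circle `S¹`, modelled as `ℝ/ℤ`. -/
abbrev Circle1 := AddCircle (1 : ℝ)

/-- The phase space `M = Σ_k × S¹`. -/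
abbrev SkewM (k : ℕ) := Shift k × Circle1

/-- Canonical projection `ℝ → S¹`. -/
def projCircle : ℝ → Circle1 := fun x => (x : Circle1)

/-- A locally constant skew product system over the full shift with circle fibers:
the fiber maps `f j` are `C¹` diffeomorphisms of the circle, recorded together with
lifts `F j : ℝ → ℝ`. -/
structure SkewSetup (k : ℕ) where
  f : Fin k → Circle1 → Circle1
  F : Fin k → ℝ → ℝ
  compat : ∀ j (x : ℝ), f j (projCircle x) = projCircle (F j x)
  F_equiv : ∀ j x, F j (x + 1) = F j x + 1
  F_smooth : ∀ j, ContDiff ℝ 1 (F j)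
  F_bij : ∀ j, Function.Bijective (F j)
  Finv_smooth : ∀ j, ContDiff ℝ 1 (Function.invFun (F j))

/-- The skew product map `T(ξ,x) = (σξ, f_{ξ₀} x)`. -/
def SkewSetup.T {k : ℕ} (S : SkewSetup k) : SkewM k → SkewM k :=
  fun z => (shiftMap k z.1, S.f (z.1 0) z.2)

/-- The composition `f_{w (m-1)} ∘ ⋯ ∘ f_{w 0}` of the fiber maps along a word `w`. -/
def SkewSetup.wordComp {k : ℕ} (S : SkewSetup k) (w : ℕ → Fin k) : ℕ → Circle1 → Circle1
  | 0 => id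
  | m + 1 => S.f (w m) ∘ S.wordComp w m

/-- The corresponding composition of the lifts. -/
def SkewSetup.wordCompLift {k : ℕ} (S : SkewSetup k) (w : ℕ → Fin k) : ℕ → ℝ → ℝ
  | 0 => id
  | m + 1 => S.F (w m) ∘ S.wordCompLift w m

/-- A sequence of `T`-periodic orbits with repetitive pattern (Definition 2.2 of the paper).
The `n`-th periodic point is `(ξ n, q n)` where `ξ n` is the infinite repetition of the
word `w n 0, …, w n (π n - 1)`; the intervals `J n ⊆ S¹` are the arcs
`projCircle '' Icc (a n) (b n)`. -/
structure RepetitivePattern {k : ℕ} (S : SkewSetup k) where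
  /-- the periods -/
  π : ℕ → ℕ
  π_pos : ∀ n, 0 < π n
  /-- the words (`w n i` is the letter `ω^n_{i+1}` of the paper) -/
  w : ℕ → ℕ → Fin k
  /-- the fiber coordinates of the periodic points -/
  q : ℕ → Circle1
  /-- endpoints of (lifts of) the intervals `J n` -/
  a : ℕ → ℝ
  b : ℕ → ℝ
  a_lt_b : ∀ n, a n < b n
  nested : ∀ n, Icc (a (n + 1)) (b (n + 1)) ⊆ Icc (a n) (b n)
  len_lt : ∀ n, b (n + 1) - a (n + 1) < b n - a n
  len_to_zero : Tendsto (fun n => b n - a n) atTop (nhds 0)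
  q_mem : ∀ n, q n ∈ projCircle '' Icc (a n) (b n)
  /-- `J 0, f_{ω^0_1}(J 0), …, f_{ω^0_{π 0 - 1}}∘⋯∘f_{ω^0_1}(J 0)` are pairwise disjoint -/
  disjoint0 : ∀ ℓ₁ ℓ₂, ℓ₁ < ℓ₂ → ℓ₂ < π 0 →
    Disjoint (S.wordComp (w 0) ℓ₁ '' (projCircle '' Icc (a 0) (b 0)))
             (S.wordComp (w 0) ℓ₂ '' (projCircle '' Icc (a 0) (b 0)))
  /-- `q n` is fixed by `g n = f_{ω^n_{π n}} ∘ ⋯ ∘ f_{ω^n_1}` -/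
  fixed : ∀ n, S.wordComp (w n) (π n) (q n) = q n
  /-- `|g_n'| < 1` on `J n` -/
  contracting : ∀ n, ∀ x ∈ Icc (a n) (b n), |deriv (S.wordCompLift (w n) (π n)) x| < 1
  /-- the numbers `k_n` (for `n ≥ 1`) -/
  kseq : ℕ → ℕ
  /-- the numbers `R_n` (for `n ≥ 1`) -/
  Rseq : ℕ → ℕ
  kseq_ge : ∀ n, 2 ≤ kseq (n + 1)
  Rseq_ge : ∀ n, 1 ≤ Rseq (n + 1)
  /-- `g (n+1) = T_{R (n+1)} ∘ (g n)^{k (n+1)}`, encoded on the level of words: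
  the word of `ξ (n+1)` is `k (n+1)` repetitions of the word of `ξ n` followed by a
  word of length `R (n+1)` -/
  period_eq : ∀ n, π (n + 1) = kseq (n + 1) * π n + Rseq (n + 1)
  word_eq : ∀ n, ∀ i < kseq (n + 1) * π n, w (n + 1) i = w n (i % π n)
  /-- the sequence `λ_n = R_n / (k_n π_{n-1})` is summable -/
  lam_summable : Summable fun n => (Rseq (n + 1) : ℝ) / (kseq (n + 1) * π n)

namespace RepetitivePattern

variable {k : ℕ} {S : SkewSetup k}

/-- The `σ`-periodic point `ξ n`, the infinite repetition of the `n`-th word. -/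
def ξp (P : RepetitivePattern S) (n : ℕ) : Shift k :=
  fun i => P.w n (Int.toNat (i % (P.π n : ℤ)))

/-- The measure `μ_{X_n}`, uniformly distributed on the `n`-th periodic orbit. -/
def μX (P : RepetitivePattern S) (n : ℕ) : Measure (SkewM k) :=
  (P.π n : ℝ≥0∞)⁻¹ • ∑ ℓ ∈ Finset.range (P.π n), Measure.dirac (S.T^[ℓ] (P.ξp n, P.q n))

/-- The projected measure `ν_n`, uniformly distributed on the `σ`-orbit of `ξ n`. -/
def νX (P : RepetitivePattern S) (n : ℕ) : Measure (Shift k) :=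
  (P.π n : ℝ≥0∞)⁻¹ • ∑ ℓ ∈ Finset.range (P.π n), Measure.dirac ((shiftMap k)^[ℓ] (P.ξp n))

end RepetitivePattern

/-- Weak-star convergence of a sequence of measures. -/
def WeakStarTendsto {X : Type*} [TopologicalSpace X] [MeasurableSpace X]
    (μs : ℕ → Measure X) (μ : Measure X) : Prop :=
  ∀ g : C(X, ℝ), Tendsto (fun n => ∫ x, g x ∂(μs n)) atTop (nhds (∫ x, g x ∂μ))

/-- A probability measure on `M` has periodic repetitive pattern if it is the weak-star
limit of the measures `μ_{X_n}` for some sequence of periodic orbits with repetitive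
pattern. -/
def HasPeriodicRepetitivePattern {k : ℕ} (S : SkewSetup k) (μ : Measure (SkewM k)) : Prop :=
  ∃ P : RepetitivePattern S, WeakStarTendsto (fun n => P.μX n) μ

/-- The Kolmogorov–Sinai (measure-theoretic) entropy of `T` with respect to `μ`:
the supremum, over all finite measurable colorings `c : X → Fin m`, of the entropy of the
associated process, the latter being computed (via subadditivity) as the infimum of
`H_n/n` where `H_n` is the Shannon entropy of the partition of `X` according to the
itinerary `(c x, c (T x), …, c (T^{n-1} x))`. -/
def ksEntropy {X : Type*} [MeasurableSpace X] (T : X → X) (μ : Measure X) : ℝ≥0∞ :=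
  ⨆ (m : ℕ) (c : {c : X → Fin m // Measurable c}),
    ⨅ n : ℕ, ENNReal.ofReal
      ((∑ s : Fin (n + 1) → Fin m,
        Real.negMulLog ((μ {x | ∀ i : Fin (n + 1), c.1 (T^[(i : ℕ)] x) = s i}).toReal))
        / ((n : ℝ) + 1))


/-- Gibbs' inequality. -/
lemma sum_negMulLog_le_cross_entropy {ι : Type*} [Fintype ι] {P Q : ι → ℝ} (hP : ∀ s, 0 ≤ P s)
    (hP1 : ∑ s, P s = 1) (hQ : ∀ s, 0 < Q s) (hQ1 : ∑ s, Q s ≤ 1) :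
    ∑ s, Real.negMulLog (P s) ≤ ∑ s, P s * -Real.log (Q s) := by
  have key : ∀ s, Real.negMulLog (P s) ≤ P s * -Real.log (Q s) + (Q s - P s) := by
    intro s
    rcases (hP s).eq_or_lt with h | h
    · simp [← h, (hQ s).le]
    · have h1 := Real.log_le_sub_one_of_pos (div_pos (hQ s) h)
      rw [Real.log_div (hQ s).ne' h.ne'] at h1
      have h2 := mul_le_mul_of_nonneg_left h1 h.le
      have h3 : P s * (Q s / P s - 1) = Q s - P s := by field_simp
      rw [h3] at h2
      simp only [Real.negMulLog]
      linarith
  calc _ ≤ ∑ s, (P s * -Real.log (Q s) + (Q s - P s)) := Finset.sum_le_sum fun s _ => key s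
    _ = ∑ s, P s * -Real.log (Q s) + (∑ s, Q s - ∑ s, P s) := by
      rw [Finset.sum_add_distrib, Finset.sum_sub_distrib]
    _ ≤ _ := by linarith

/-- A sub-probability vector on words which gives a cheap code for words that are close, in
Hamming distance, to one of the words `a ι`. -/
lemma exists_code_weights {I : Type*} [Fintype I] [Nonempty I] {n m : ℕ} (hm : 0 < m)
    (a : I → Fin n → Fin m) (K : ℝ) :
    ∃ Q : (Fin n → Fin m) → ℝ, (∀ s, 0 < Q s) ∧ ∑ s, Q s ≤ 1 ∧
      (∀ s, -Real.log (Q s) ≤ Real.log 2 + n * Real.log m) ∧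
      ∀ ι s, -Real.log (Q s) ≤ Real.log 2 + Real.log (Fintype.card I)
        + n * (m * Real.exp (-K)) + K * ∑ i, if s i = a ι i then (0 : ℝ) else 1 := by
  set t := Real.exp (-K) with ht
  have ht0 : 0 < t := Real.exp_pos _
  have hm' : (0 : ℝ) < m := by exact_mod_cast hm
  have hI : (0 : ℝ) < Fintype.card I := by exact_mod_cast Fintype.card_pos
  set V : I → (Fin n → Fin m) → ℝ := fun ι s => ∏ i, if s i = a ι i then 1 else t with hV
  have hVpos : ∀ ι s, 0 < V ι s := fun ι s => Finset.prod_pos fun i _ => by split_ifs <;> positivity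
  set D : ℝ := (1 + m * t) ^ n with hD
  have hD0 : 0 < D := by positivity
  have hVsum : ∀ ι, ∑ s, V ι s ≤ D := by
    intro ι
    have h := Finset.prod_univ_sum (fun _ : Fin n => (Finset.univ : Finset (Fin m)))
      (fun i v => if v = a ι i then (1 : ℝ) else t)
    rw [Fintype.piFinset_univ] at h
    rw [hV, ← h, hD]
    calc _ ≤ ∏ _i : Fin n, (1 + m * t) := by
          refine Finset.prod_le_prod (fun i _ => Finset.sum_nonneg fun v _ => by
            split_ifs <;> positivity) fun i _ => ?_
          calc ∑ v, (if v = a ι i then (1 : ℝ) else t)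
              ≤ ∑ v, ((if v = a ι i then (1 : ℝ) else 0) + t) :=
                Finset.sum_le_sum fun v _ => by split_ifs <;> linarith
            _ = 1 + m * t := by simp [Finset.sum_add_distrib]
      _ = _ := by simp
  set W : (Fin n → Fin m) → ℝ := fun s => (Fintype.card I * D)⁻¹ * ∑ ι, V ι s with hW
  have hWpos : ∀ s, 0 < W s := fun s =>
    mul_pos (by positivity) (Finset.sum_pos (fun ι _ => hVpos ι s) Finset.univ_nonempty)
  have hWsum : ∑ s, W s ≤ 1 := by
    rw [hW, ← Finset.mul_sum, Finset.sum_comm, inv_mul_le_iff₀ (by positivity), mul_one]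
    calc _ ≤ ∑ _ι : I, D := Finset.sum_le_sum fun ι _ => hVsum ι
      _ = _ := by simp
  have hQpos : ∀ s, 0 < ((m : ℝ) ^ n)⁻¹ / 2 + W s / 2 := fun s => by
    have := hWpos s
    positivity
  refine ⟨fun s => ((m : ℝ) ^ n)⁻¹ / 2 + W s / 2, hQpos, ?_, fun s => ?_, fun ι s => ?_⟩
  · rw [Finset.sum_add_distrib, ← Finset.sum_div, ← Finset.sum_div]
    have : ∑ _s : Fin n → Fin m, ((m : ℝ) ^ n)⁻¹ = 1 := by
      simp [mul_inv_cancel₀ (pow_pos hm' n).ne']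
    linarith
  · have h1 : Real.log (((m : ℝ) ^ n)⁻¹ / 2) ≤ Real.log (((m : ℝ) ^ n)⁻¹ / 2 + W s / 2) :=
      Real.log_le_log (by positivity) (by linarith [hWpos s])
    rw [Real.log_div (by positivity) (by norm_num), Real.log_inv, Real.log_pow] at h1
    linarith
  · have h0 : (Fintype.card I * D)⁻¹ * V ι s ≤ W s :=
      mul_le_mul_of_nonneg_left
        (Finset.single_le_sum (fun ι _ => (hVpos ι s).le) (Finset.mem_univ ι)) (by positivity)
    have hV0 := hVpos ι s
    have h1 : Real.log ((Fintype.card I * D)⁻¹ * V ι s / 2)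
        ≤ Real.log (((m : ℝ) ^ n)⁻¹ / 2 + W s / 2) :=
      Real.log_le_log (by positivity) (by
        have : 0 < ((m : ℝ) ^ n)⁻¹ / 2 := by positivity
        linarith)
    rw [Real.log_div (by positivity) (by norm_num), Real.log_mul (by positivity) hV0.ne',
      Real.log_inv, Real.log_mul hI.ne' hD0.ne', hD, Real.log_pow] at h1
    have h2 : Real.log (1 + m * t) ≤ m * t := by
      linarith [Real.log_le_sub_one_of_pos (show 0 < 1 + m * t by positivity)]
    have h3 : Real.log (V ι s) = -(K * ∑ i, if s i = a ι i then (0 : ℝ) else 1) := by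
      rw [hV, Real.log_prod (fun i _ => by split_ifs <;> positivity), Finset.mul_sum,
        ← Finset.sum_neg_distrib]
      refine Finset.sum_congr rfl fun i _ => ?_
      split_ifs <;> simp [ht]
    have h4 : (n : ℝ) * Real.log (1 + m * t) ≤ n * (m * t) := by gcongr
    linarith

/-- If, outside of a set of small measure, the orbit segments of length `n` fall into few classes,
and points in the same class have the same itinerary except at times of visit to `B`, then the
entropy of the partition into itineraries is small. -/
lemma itinerary_entropy_le {X : Type*} [MeasurableSpace X] {μ : Measure X} [IsProbabilityMeasure μ]
    {T : X → X} (hT : MeasurePreserving T μ μ) {n m : ℕ} {c : X → Fin m} (hc : Measurable c)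
    {B G : Set X} (hB : MeasurableSet B) (hG : MeasurableSet G) {I : Type*} [Fintype I] [Nonempty I]
    {R : I → X → Prop} (hR : ∀ x ∈ G, ∃ ι, R ι x)
    (hcons : ∀ ι x y, R ι x → R ι y → ∀ i < n, T^[i] x ∉ B → T^[i] y ∉ B →
      c (T^[i] x) = c (T^[i] y)) {K : ℝ} (hK : 0 ≤ K) :
    ∑ s : Fin n → Fin m, Real.negMulLog ((μ {x | ∀ i : Fin n, c (T^[(i : ℕ)] x) = s i}).toReal)
      ≤ Real.log 2 + Real.log (Fintype.card I) + n * (m * Real.exp (-K)) + n * (K * μ.real B)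
        + n * Real.log m * μ.real Gᶜ := by
  classical
  obtain ⟨x₀⟩ : Nonempty X := μ.nonempty_of_neZero
  have hm : 0 < m := (c x₀).pos
  let a : I → Fin n → Fin m := fun ι i =>
    if h : ∃ x, R ι x ∧ T^[(i : ℕ)] x ∉ B then c (T^[(i : ℕ)] h.choose) else ⟨0, hm⟩
  have ha : ∀ ι x, R ι x → ∀ i : Fin n, T^[(i : ℕ)] x ∉ B → c (T^[(i : ℕ)] x) = a ι i := by
    intro ι x hx i hi
    have h : ∃ x, R ι x ∧ T^[(i : ℕ)] x ∉ B := ⟨x, hx, hi⟩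
    simp only [a, dif_pos h]
    exact hcons ι x _ hx h.choose_spec.1 i i.2 hi h.choose_spec.2
  obtain ⟨Q, hQ0, hQ1, hQm, hQI⟩ := exists_code_weights hm a K
  set itin : X → Fin n → Fin m := fun x i => c (T^[(i : ℕ)] x) with hitin
  have hmeas : Measurable itin :=
    measurable_pi_lambda _ fun i => hc.comp (hT.measurable.iterate i)
  have hprob : IsProbabilityMeasure (μ.map itin) := Measure.isProbabilityMeasure_map hmeas.aemeasurable
  have hP : ∀ s, (μ {x | ∀ i : Fin n, c (T^[(i : ℕ)] x) = s i}).toReal = (μ.map itin).real {s} := by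
    intro s
    rw [measureReal_def, Measure.map_apply hmeas (measurableSet_singleton s)]
    congr 2
    ext x
    simp [hitin, funext_iff]
  simp_rw [hP]
  refine (sum_negMulLog_le_cross_entropy (fun _ => measureReal_nonneg) ?_ hQ0 hQ1).trans ?_
  · rw [sum_measureReal_singleton]
    simp
  set C := Real.log 2 + Real.log (Fintype.card I) + n * (m * Real.exp (-K)) with hC
  have hlogI : 0 ≤ Real.log (Fintype.card I) := Real.log_natCast_nonneg _
  have hlogm : 0 ≤ Real.log m := Real.log_natCast_nonneg _
  have hTB : ∀ i : Fin n, MeasurableSet (T^[(i : ℕ)] ⁻¹' B) := fun i => hT.measurable.iterate i hB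
  have hint : ∀ i : Fin n, Integrable ((T^[(i : ℕ)] ⁻¹' B).indicator (1 : X → ℝ)) μ := fun i =>
    (integrable_const (1 : ℝ)).indicator (hTB i)
  have hpt : ∀ x, -Real.log (Q (itin x)) ≤ C
      + K * ∑ i : Fin n, (T^[(i : ℕ)] ⁻¹' B).indicator (1 : X → ℝ) x
      + n * Real.log m * Gᶜ.indicator (1 : X → ℝ) x := by
    intro x
    have hnn : 0 ≤ ∑ i : Fin n, (T^[(i : ℕ)] ⁻¹' B).indicator (1 : X → ℝ) x :=
      Finset.sum_nonneg fun i _ => indicator_nonneg (fun _ _ => zero_le_one) _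
    by_cases hx : x ∈ G
    · obtain ⟨ι, hι⟩ := hR x hx
      refine (hQI ι (itin x)).trans ?_
      have : (∑ i, if itin x i = a ι i then (0 : ℝ) else 1)
          ≤ ∑ i : Fin n, (T^[(i : ℕ)] ⁻¹' B).indicator (1 : X → ℝ) x := by
        refine Finset.sum_le_sum fun i _ => ?_
        by_cases hi : T^[(i : ℕ)] x ∈ B
        · rw [indicator_of_mem (by exact hi)]
          split_ifs <;> simp
        · rw [if_pos (ha ι x hι i hi)]
          exact indicator_nonneg (fun _ _ => zero_le_one) _
      have := mul_le_mul_of_nonneg_left this hK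
      simp only [mem_compl_iff, hx, not_true_eq_false, not_false_eq_true, indicator_of_notMem,
        mul_zero, add_zero]
      linarith
    · refine (hQm (itin x)).trans ?_
      rw [indicator_of_mem (by exact hx)]
      have := mul_nonneg hK hnn
      have : 0 ≤ n * (m * Real.exp (-K)) := by positivity
      simp only [Pi.one_apply, mul_one]
      linarith
  calc ∑ s, (μ.map itin).real {s} * -Real.log (Q s)
      = ∫ x, -Real.log (Q (itin x)) ∂μ := by
        rw [← integral_map (f := fun s => -Real.log (Q s)) hmeas.aemeasurable
          (measurable_of_finite _).aestronglyMeasurable, integral_fintype .of_finite]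
        simp
    _ ≤ ∫ x, (C + K * ∑ i : Fin n, (T^[(i : ℕ)] ⁻¹' B).indicator (1 : X → ℝ) x
          + n * Real.log m * Gᶜ.indicator (1 : X → ℝ) x) ∂μ := by
        refine integral_mono ?_ ?_ hpt
        · exact Integrable.comp_measurable (f := itin) (g := fun s => -Real.log (Q s))
            .of_finite hmeas
        · exact ((integrable_const _).add ((integrable_finsetSum _ fun i _ => hint i).const_mul _)).add
            (((integrable_const (1 : ℝ)).indicator hG.compl).const_mul _)
    _ = _ := by
        rw [integral_add, integral_add, integral_const_mul, integral_const_mul,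
          integral_finsetSum _ fun i _ => hint i, integral_indicator_one hG.compl]
        · have : ∀ i : Fin n, ∫ x, (T^[(i : ℕ)] ⁻¹' B).indicator (1 : X → ℝ) x ∂μ = μ.real B := by
            intro i
            rw [integral_indicator_one (hTB i), measureReal_def,
              (hT.iterate i).measure_preimage hB.nullMeasurableSet, measureReal_def]
          simp only [this]
          simp
          ring
        · exact integrable_const _
        · exact (integrable_finsetSum _ fun i _ => hint i).const_mul _
        · exact (integrable_const _).add ((integrable_finsetSum _ fun i _ => hint i).const_mul _)
        · exact ((integrable_const (1 : ℝ)).indicator hG.compl).const_mul _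

/-- Two points of `M` are `L`-close if their base coordinates agree on `[-L, L]` and their fiber
coordinates are at distance at most `1 / (L + 1)`. -/
def SkewClose {k : ℕ} (L : ℕ) (z z' : SkewM k) : Prop :=
  (∀ i : ℤ, -L ≤ i → i ≤ L → z.1 i = z'.1 i) ∧ dist z.2 z'.2 ≤ 1 / ((L : ℝ) + 1)

lemma SkewClose.mono {k L L' : ℕ} (h : L ≤ L') {z z' : SkewM k} (hz : SkewClose L' z z') :
    SkewClose L z z' := by
  refine ⟨fun i h1 h2 => hz.1 i (by omega) (by omega), hz.2.trans ?_⟩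
  gcongr

lemma isClosed_skewClose {k : ℕ} (L : ℕ) :
    IsClosed {p : SkewM k × SkewM k | SkewClose L p.1 p.2} := by
  simp only [SkewClose, ofPred_and, ofPred_forall]
  refine IsClosed.inter ?_ (isClosed_le (by fun_prop) (by fun_prop))
  exact isClosed_iInter fun i => isClosed_iInter fun _ => isClosed_iInter fun _ =>
    isClosed_eq (by fun_prop) (by fun_prop)

lemma eq_of_forall_skewClose {k : ℕ} {z z' : SkewM k} (h : ∀ L, SkewClose L z z') : z = z' := by
  refine Prod.ext (funext fun i => (h i.natAbs).1 i (by omega) (by omega)) ?_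
  refine dist_le_zero.1 (ge_of_tendsto' tendsto_one_div_add_atTop_nhds_zero_nat fun L => (h L).2)

lemma exists_forall_not_skewClose {k : ℕ} {A B : Set (SkewM k)} (hA : IsClosed A) (hB : IsClosed B)
    (hAB : Disjoint A B) : ∃ L, ∀ z ∈ A, ∀ z' ∈ B, ¬ SkewClose L z z' := by
  obtain ⟨L, hL⟩ := (hA.prod hB).isCompact.elim_directed_family_closed
    (fun L => {p : SkewM k × SkewM k | SkewClose L p.1 p.2}) isClosed_skewClose
    (by
      rw [eq_empty_iff_forall_notMem]
      rintro ⟨z, z'⟩ ⟨⟨h1, h2⟩, h3⟩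
      simp only [mem_iInter, mem_ofPred_eq] at h3
      exact hAB.ne_of_mem h1 h2 (eq_of_forall_skewClose h3))
    (fun L L' => ⟨max L L', fun _ hp => SkewClose.mono (le_max_left _ _) hp,
      fun _ hp => SkewClose.mono (le_max_right _ _) hp⟩)
  exact ⟨L, fun z hz z' hz' h => (eq_empty_iff_forall_notMem.1 hL) (z, z') ⟨⟨hz, hz'⟩, h⟩⟩

/-- A Lusin-type property: a finite coloring is locally constant, at a uniform scale, off a set
of small measure. -/
lemma exists_skewClose_eq {k m : ℕ} (μ : Measure (SkewM k)) [IsProbabilityMeasure μ]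
    {c : SkewM k → Fin m} (hc : Measurable c) {δ : ℝ} (hδ : 0 < δ) :
    ∃ (B : Set (SkewM k)) (L : ℕ), MeasurableSet B ∧ μ.real B ≤ δ ∧
      ∀ z z', z ∉ B → z' ∉ B → SkewClose L z z' → c z = c z' := by
  have hm : 0 < m := (c μ.nonempty_of_neZero.some).pos
  have hm' : (0 : ℝ) < m := by exact_mod_cast hm
  have hE : ∀ j, MeasurableSet (c ⁻¹' {j}) := fun j => hc (measurableSet_singleton j)
  have hε : ENNReal.ofReal (δ / m) ≠ 0 := by
    rw [Ne, ENNReal.ofReal_eq_zero, not_le]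
    positivity
  choose F hFsub hFc hFμ using fun j =>
    (hE j).exists_isClosed_sdiff_lt (measure_ne_top μ _) hε
  have hsep : ∀ p : Fin m × Fin m, ∃ L, p.1 ≠ p.2 →
      ∀ z ∈ F p.1, ∀ z' ∈ F p.2, ¬ SkewClose L z z' := by
    intro p
    by_cases hp : p.1 = p.2
    · exact ⟨0, fun h => (h hp).elim⟩
    · obtain ⟨L, hL⟩ := exists_forall_not_skewClose (hFc p.1) (hFc p.2)
        (disjoint_left.2 fun z h1 h2 => hp ((hFsub _ h1).symm.trans (hFsub _ h2)))
      exact ⟨L, fun _ => hL⟩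
  choose Lf hLf using hsep
  refine ⟨⋃ j, c ⁻¹' {j} \ F j, Finset.univ.sup Lf,
    MeasurableSet.iUnion fun j => (hE j).diff (hFc j).measurableSet, ?_, ?_⟩
  · refine (measureReal_iUnion_fintype_le _).trans ?_
    calc _ ≤ ∑ _j : Fin m, δ / m := Finset.sum_le_sum fun j _ =>
          ENNReal.toReal_le_of_le_ofReal (by positivity) (hFμ j).le
      _ = δ := by simp; field_simp
  · intro z z' hz hz' hzz
    have hmem : ∀ z, z ∉ ⋃ j, c ⁻¹' {j} \ F j → z ∈ F (c z) := by
      intro z hz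
      by_contra h
      exact hz (mem_iUnion.2 ⟨c z, rfl, h⟩)
    by_contra hne
    exact hLf (c z, c z') hne z (hmem z hz) z' (hmem z' hz')
      (hzz.mono (Finset.le_sup (Finset.mem_univ _)))

namespace SkewSetup

variable {k : ℕ} (S : SkewSetup k)

lemma strictMono_F (j : Fin k) : StrictMono (S.F j) := by
  refine ((S.F_smooth j).continuous.strictMono_of_inj (S.F_bij j).injective).resolve_right ?_
  intro h
  have h1 := h (show (0 : ℝ) < 0 + 1 by norm_num)
  rw [S.F_equiv] at h1
  linarith

lemma monotone_wordCompLift (w : ℕ → Fin k) (n : ℕ) : Monotone (S.wordCompLift w n) := by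
  induction n with
  | zero => exact monotone_id
  | succ n ih => exact (S.strictMono_F _).monotone.comp ih

lemma wordCompLift_one (w : ℕ → Fin k) (n : ℕ) :
    S.wordCompLift w n 1 = S.wordCompLift w n 0 + 1 := by
  induction n with
  | zero => simp [wordCompLift]
  | succ n ih => simp only [wordCompLift, Function.comp_apply, ih, S.F_equiv]

lemma wordComp_projCircle (w : ℕ → Fin k) (n : ℕ) (x : ℝ) :
    S.wordComp w n (projCircle x) = projCircle (S.wordCompLift w n x) := by
  induction n with
  | zero => rfl
  | succ n ih => simp only [wordComp, wordCompLift, Function.comp_apply, ih, S.compat]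

lemma wordCompLift_congr {w w' : ℕ → Fin k} {n : ℕ} (h : ∀ i < n, w i = w' i) :
    S.wordCompLift w n = S.wordCompLift w' n := by
  induction n with
  | zero => rfl
  | succ n ih =>
    simp only [wordCompLift, ih fun i hi => h i (by omega), h n (by omega)]

lemma iterate_T (z : SkewM k) (n : ℕ) :
    S.T^[n] z = (fun i => z.1 (i + n), S.wordComp (fun i => z.1 i) n z.2) := by
  induction n with
  | zero => simp [wordComp]
  | succ n ih =>
    rw [Function.iterate_succ_apply', ih]
    refine Prod.ext (funext fun i => ?_) ?_
    · exact congrArg z.1 (by push_cast; ring)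
    · simp [T, wordComp]

/-- The total displacement, at scale `1 / N`, of the first `n` points of the fiber orbit of `x`
with respect to that of `0`. -/
def floorSum (w : ℕ → Fin k) (n N : ℕ) (x : ℝ) : ℤ :=
  ∑ i ∈ Finset.range n, (⌊N * S.wordCompLift w i x⌋ - ⌊N * S.wordCompLift w i 0⌋)

lemma floor_le_floor {w : ℕ → Fin k} (N i : ℕ) {x y : ℝ} (h : x ≤ y) :
    ⌊N * S.wordCompLift w i x⌋ ≤ ⌊N * S.wordCompLift w i y⌋ :=
  Int.floor_le_floor (mul_le_mul_of_nonneg_left (S.monotone_wordCompLift w i h) N.cast_nonneg)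

lemma floorSum_nonneg (w : ℕ → Fin k) (n N : ℕ) {x : ℝ} (hx : 0 ≤ x) :
    0 ≤ S.floorSum w n N x :=
  Finset.sum_nonneg fun i _ => sub_nonneg.2 (S.floor_le_floor N i hx)

lemma floorSum_le (w : ℕ → Fin k) (n N : ℕ) {x : ℝ} (hx : x ≤ 1) :
    S.floorSum w n N x ≤ n * N := by
  calc _ ≤ ∑ _i ∈ Finset.range n, (N : ℤ) := by
        refine Finset.sum_le_sum fun i _ => ?_
        have h := S.floor_le_floor (w := w) N i hx
        rw [S.wordCompLift_one, mul_add, mul_one, Int.floor_add_natCast] at h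
        linarith
    _ = _ := by simp

/-- By monotonicity of the fiber maps, the total displacement determines all the positions. -/
lemma floor_eq_of_floorSum_eq {w : ℕ → Fin k} {n N : ℕ} {x y : ℝ}
    (h : S.floorSum w n N x = S.floorSum w n N y) {i : ℕ} (hi : i < n) :
    ⌊N * S.wordCompLift w i x⌋ = ⌊N * S.wordCompLift w i y⌋ := by
  wlog hxy : x ≤ y generalizing x y
  · exact (this h.symm (le_of_not_ge hxy)).symm
  have := (Finset.sum_eq_sum_iff_of_le (s := Finset.range n) fun i _ =>
    sub_le_sub_right (S.floor_le_floor (w := w) N i hxy) ⌊N * S.wordCompLift w i 0⌋).1 h i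
      (Finset.mem_range.2 hi)
  linarith

lemma dist_projCircle_le (x y : ℝ) : dist (projCircle x) (projCircle y) ≤ |x - y| := by
  rw [dist_eq_norm]
  exact QuotientAddGroup.norm_mk_le_norm (m := x - y)

/-- The points whose base coordinate is `u` on `[-L, n + L)` and whose fiber orbit of length `n`
has a given total displacement. -/
def SameClass (n L : ℕ) (u : ℕ → Fin k) (v : ℤ) (z : SkewM k) : Prop :=
  (∀ j < n + 2 * L, z.1 (j - L) = u j) ∧
    ∃ x : ℝ, projCircle x = z.2 ∧ S.floorSum (fun i => u (i + L)) n (L + 1) x = v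

lemma SameClass.skewClose {S : SkewSetup k} {n L : ℕ} {u : ℕ → Fin k} {v : ℤ} {z z' : SkewM k}
    (hz : S.SameClass n L u v z) (hz' : S.SameClass n L u v z') {i : ℕ} (hi : i < n) :
    SkewClose L (S.T^[i] z) (S.T^[i] z') := by
  have hword : ∀ {z}, S.SameClass n L u v z →
      S.wordCompLift (fun i => z.1 i) i = S.wordCompLift (fun i => u (i + L)) i := by
    intro z hz
    refine S.wordCompLift_congr fun l hl => ?_
    rw [← hz.1 (l + L) (by omega)]
    exact congrArg z.1 (by push_cast; ring)
  have h1 := hword hz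
  have h2 := hword hz'
  obtain ⟨hzu, x, hx, hxv⟩ := hz
  obtain ⟨hzu', y, hy, hyv⟩ := hz'
  rw [S.iterate_T, S.iterate_T]
  constructor
  · intro l hl hl'
    have e1 := hzu (l + i + L).toNat (by omega)
    have e2 := hzu' (l + i + L).toNat (by omega)
    rw [show ((l + i + L).toNat : ℤ) - L = l + i by omega] at e1 e2
    exact e1.trans e2.symm
  · simp only [← hx, ← hy, S.wordComp_projCircle, h1, h2]
    refine (dist_projCircle_le _ _).trans ?_
    have h := Int.abs_sub_lt_one_of_floor_eq_floor (S.floor_eq_of_floorSum_eq (hxv.trans hyv.symm) hi)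
    rw [← mul_sub, abs_mul, Nat.abs_cast] at h
    push_cast at h
    rw [le_div_iff₀ (by positivity)]
    linarith

end SkewSetup

namespace RepetitivePattern

variable {k : ℕ} {S : SkewSetup k} (P : RepetitivePattern S)

/-- The times `ℓ` for which the window of length `M` starting `L` letters before `ℓ` in the
`n`-th word is a subword of the `N`-th word. -/
def GoodTime (N M L n ℓ : ℕ) : Prop :=
  ∃ s, ℓ = s + L ∧ s + M ≤ P.π n ∧ ∃ i, i + M ≤ P.π N ∧ ∀ j < M, P.w n (s + j) = P.w N (i + j)

/-- The points for which the window `[-L, M - L)` of the base coordinate is a subword of the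
`N`-th word. -/
def goodSet (N M L : ℕ) : Set (SkewM k) :=
  {z | ∃ i, i + M ≤ P.π N ∧ ∀ j < M, z.1 ((j : ℤ) - L) = P.w N (i + j)}

open Classical in
/-- The times in a period of the `n`-th word which are not good. -/
def badTimes (N M L n : ℕ) : Finset ℕ := {ℓ ∈ Finset.range (P.π n) | ¬ P.GoodTime N M L n ℓ}

variable {P}

lemma GoodTime.iterate_mem {N M L n ℓ : ℕ} (h : P.GoodTime N M L n ℓ) :
    S.T^[ℓ] (P.ξp n, P.q n) ∈ P.goodSet N M L := by
  obtain ⟨s, rfl, hs, i, hi, hw⟩ := h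
  refine ⟨i, hi, fun j hj => ?_⟩
  rw [← hw j hj, S.iterate_T]
  simp only [ξp]
  rw [show ((j : ℤ) - L + ((s + L : ℕ) : ℤ)) = ((s + j : ℕ) : ℤ) by push_cast; ring,
    ← Int.natCast_mod, Int.toNat_natCast, Nat.mod_eq_of_lt (by omega)]

variable (P)

lemma isClopen_goodSet (N M L : ℕ) : IsClopen (P.goodSet N M L) := by
  have h : P.goodSet N M L = ⋃ i ∈ {i | i + M ≤ P.π N}, ⋂ j ∈ {j | j < M},
      (fun z : SkewM k => z.1 ((j : ℤ) - L)) ⁻¹' {P.w N (i + j)} := by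
    ext z
    simp [goodSet]
  rw [h]
  have hfin : {i | i + M ≤ P.π N}.Finite := (finite_Iic (P.π N)).subset fun i hi => by
    simp only [mem_ofPred_eq, mem_Iic] at hi ⊢
    omega
  refine hfin.isClopen_biUnion fun i _ => (finite_lt_nat M).isClopen_biInter fun j _ => ?_
  exact (isClopen_discrete _).preimage (by fun_prop)

lemma card_badTimes_self {N M L : ℕ} (hL : L ≤ M) : (P.badTimes N M L N).card ≤ M := by
  have hsub : P.badTimes N M L N ⊆ Finset.range L ∪ Finset.Ico (P.π N + L - M) (P.π N) := by
    intro ℓ hℓ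
    simp only [badTimes, Finset.mem_filter, Finset.mem_range, Finset.mem_union,
      Finset.mem_Ico] at hℓ ⊢
    by_contra hcon
    exact hℓ.2 ⟨ℓ - L, by omega, by omega, ℓ - L, by omega, fun _ _ => rfl⟩
  refine (Finset.card_le_card hsub).trans ((Finset.card_union_le _ _).trans ?_)
  simp only [Finset.card_range, Nat.card_Ico]
  omega

lemma card_badTimes_succ (N M L n : ℕ) :
    (P.badTimes N M L (n + 1)).card ≤ P.kseq (n + 1) * (P.badTimes N M L n).card
      + P.Rseq (n + 1) := by
  have hsub : P.badTimes N M L (n + 1) ⊆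
      (Finset.range (P.kseq (n + 1)) ×ˢ P.badTimes N M L n).image (fun p => p.1 * P.π n + p.2)
        ∪ Finset.Ico (P.kseq (n + 1) * P.π n) (P.π (n + 1)) := by
    intro ℓ hℓ
    simp only [badTimes, Finset.mem_filter, Finset.mem_range] at hℓ
    obtain ⟨hℓ1, hℓ2⟩ := hℓ
    rw [Finset.mem_union]
    by_cases hlt : ℓ < P.kseq (n + 1) * P.π n
    · left
      have hdiv : ℓ / P.π n < P.kseq (n + 1) := (Nat.div_lt_iff_lt_mul (P.π_pos n)).2 hlt
      have hsum : ℓ / P.π n * P.π n + ℓ % P.π n = ℓ := Nat.div_add_mod' ℓ (P.π n)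
      refine Finset.mem_image.2 ⟨(ℓ / P.π n, ℓ % P.π n), ?_, hsum⟩
      simp only [badTimes, Finset.mem_product, Finset.mem_filter, Finset.mem_range]
      refine ⟨hdiv, Nat.mod_lt _ (P.π_pos n), ?_⟩
      rintro ⟨s, hs, hsM, i, hi, hw⟩
      have hmul : (ℓ / P.π n + 1) * P.π n ≤ P.kseq (n + 1) * P.π n :=
        Nat.mul_le_mul_right _ hdiv
      rw [add_mul, one_mul] at hmul
      have hper := P.period_eq n
      refine hℓ2 ⟨ℓ / P.π n * P.π n + s, by omega, by omega, i, hi, fun j hj => ?_⟩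
      rw [← hw j hj, P.word_eq n _ (by omega), add_assoc, add_comm, Nat.add_mul_mod_self_right,
        Nat.mod_eq_of_lt (by omega)]
    · right
      simp only [Finset.mem_Ico]
      omega
  refine (Finset.card_le_card hsub).trans ((Finset.card_union_le _ _).trans ?_)
  refine Nat.add_le_add (Finset.card_image_le.trans ?_) ?_
  · simp
  · simp [P.period_eq n]

/-- The summable sequence `R_n / (k_n π_{n-1})`, shifted by one. -/
def lam (n : ℕ) : ℝ := (P.Rseq (n + 1) : ℝ) / (P.kseq (n + 1) * P.π n)

lemma lam_nonneg (n : ℕ) : 0 ≤ P.lam n := by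
  unfold lam
  positivity

lemma card_badTimes_div_le {N M L : ℕ} (hL : L ≤ M) (n : ℕ) :
    ((P.badTimes N M L (n + N)).card : ℝ) / P.π (n + N)
      ≤ (M : ℝ) / P.π N + ∑ j ∈ Finset.range n, P.lam (j + N) := by
  induction n with
  | zero =>
    simp only [zero_add, Finset.range_zero, Finset.sum_empty, add_zero]
    gcongr
    exact P.card_badTimes_self hL
  | succ n ih =>
    rw [Finset.sum_range_succ, show n + 1 + N = n + N + 1 by omega]
    set l := n + N
    have hk : (0 : ℝ) < P.kseq (l + 1) := by
      have := P.kseq_ge l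
      exact_mod_cast (by omega : 0 < P.kseq (l + 1))
    have hπ : (0 : ℝ) < P.π l := by exact_mod_cast P.π_pos l
    have hπ' : (P.kseq (l + 1) : ℝ) * P.π l ≤ P.π (l + 1) := by
      rw [P.period_eq l]
      push_cast
      linarith [(P.Rseq (l + 1)).cast_nonneg (α := ℝ)]
    have hcard : ((P.badTimes N M L (l + 1)).card : ℝ)
        ≤ P.kseq (l + 1) * (P.badTimes N M L l).card + P.Rseq (l + 1) := by
      exact_mod_cast P.card_badTimes_succ N M L l
    calc _ ≤ (P.kseq (l + 1) * (P.badTimes N M L l).card + P.Rseq (l + 1) : ℝ)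
          / (P.kseq (l + 1) * P.π l) := by gcongr
      _ = (P.badTimes N M L l).card / P.π l + P.lam l := by
          rw [add_div, mul_div_mul_left _ _ hk.ne', lam]
      _ ≤ _ := by linarith

lemma integral_μX (n : ℕ) {g : SkewM k → ℝ} :
    ∫ x, g x ∂P.μX n = (P.π n : ℝ)⁻¹ *
      ∑ ℓ ∈ Finset.range (P.π n), g (S.T^[ℓ] (P.ξp n, P.q n)) := by
  rw [μX, integral_smul_measure, integral_finsetSum_measure fun _ _ => integrable_dirac (by simp)]
  simp [integral_dirac]

lemma measureReal_compl_goodSet_le {μ : Measure (SkewM k)} [IsProbabilityMeasure μ]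
    (hμ : WeakStarTendsto (fun n => P.μX n) μ) {N M L : ℕ} (hL : L ≤ M) :
    μ.real (P.goodSet N M L)ᶜ ≤ (M : ℝ) / P.π N + ∑' j, P.lam (j + N) := by
  have hcl := (P.isClopen_goodSet N M L).compl
  have h := hμ ⟨(P.goodSet N M L)ᶜ.indicator 1, hcl.continuous_indicator continuous_one⟩
  simp only [ContinuousMap.coe_mk, integral_indicator_one hcl.isOpen.measurableSet] at h
  refine le_of_tendsto ((tendsto_add_atTop_iff_nat N).2 h) (Eventually.of_forall fun n => ?_)
  have hsum : ∑ j ∈ Finset.range n, P.lam (j + N) ≤ ∑' j, P.lam (j + N) :=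
    ((summable_nat_add_iff N).2 P.lam_summable).sum_le_tsum _ fun j _ => P.lam_nonneg _
  refine le_trans ?_ ((P.card_badTimes_div_le hL n).trans (add_le_add_right hsum _))
  rw [← integral_indicator_one hcl.isOpen.measurableSet, P.integral_μX, div_eq_inv_mul]
  gcongr
  rw [badTimes, Finset.card_filter]
  push_cast
  refine Finset.sum_le_sum fun ℓ _ => ?_
  by_cases hℓ : P.GoodTime N M L (n + N) ℓ
  · rw [indicator_of_notMem (notMem_compl_iff.2 hℓ.iterate_mem)]
    simp [hℓ]
  · simp only [hℓ, not_false_eq_true, if_true]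
    exact indicator_le_self' (fun _ _ => zero_le_one) _

lemma le_π (n : ℕ) : n ≤ P.π n := by
  induction n with
  | zero => exact Nat.zero_le _
  | succ n ih =>
    have h1 := P.kseq_ge n
    have h2 := P.Rseq_ge n
    have h3 : 1 * P.π n ≤ P.kseq (n + 1) * P.π n := Nat.mul_le_mul_right _ (by omega)
    rw [P.period_eq]
    omega

end RepetitivePattern

namespace RepetitivePattern

variable {k : ℕ} {S : SkewSetup k} (P : RepetitivePattern S)

lemma itinerary_entropy_div_le {μ : Measure (SkewM k)} [IsProbabilityMeasure μ]
    (hT : MeasurePreserving S.T μ μ) (hμ : WeakStarTendsto (fun n => P.μX n) μ) {m : ℕ}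
    {c : SkewM k → Fin m} (hc : Measurable c) {B : Set (SkewM k)} (hB : MeasurableSet B) {L : ℕ}
    (hBc : ∀ z z', z ∉ B → z' ∉ B → SkewClose L z z' → c z = c z') {K : ℝ} (hK : 0 ≤ K)
    {N n : ℕ} (hn : 0 < n) (hn1 : n ^ 2 ≤ P.π N) (hn2 : P.π N ≤ (n + 1) ^ 2) :
    (∑ s : Fin n → Fin m,
      Real.negMulLog ((μ {x | ∀ i : Fin n, c (S.T^[(i : ℕ)] x) = s i}).toReal)) / n
      ≤ (4 * Real.log 2 + Real.log (L + 1) + Real.log m * (1 + 2 * L)) / n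
        + 3 * (Real.log n / n) + Real.log m * ∑' j, P.lam (j + N)
        + (m * Real.exp (-K) + K * μ.real B) := by
  have hn0 : (0 : ℝ) < n := by exact_mod_cast hn
  have hn1' : (1 : ℝ) ≤ n := by exact_mod_cast hn
  have hπ : (0 : ℝ) < P.π N := by exact_mod_cast P.π_pos N
  have hlogm : 0 ≤ Real.log m := Real.log_natCast_nonneg _
  have : Nonempty (Fin (P.π N)) := ⟨⟨0, P.π_pos N⟩⟩
  have hmain := itinerary_entropy_le (n := n) hT hc hB
    (P.isClopen_goodSet N (n + 2 * L) L).isOpen.measurableSet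
    (I := Fin (P.π N) × Fin (n * (L + 1) + 1))
    (R := fun p z => S.SameClass n L (fun j => P.w N (p.1 + j)) (p.2 : ℕ) z)
    (by
      rintro z ⟨i, hi, hz⟩
      obtain ⟨x, hx, hxz⟩ := AddCircle.eq_coe_Ico z.2
      set w : ℕ → Fin k := fun l => P.w N (i + (l + L)) with hw
      have h0 := S.floorSum_nonneg w n (L + 1) hx.1
      have h1 := S.floorSum_le w n (L + 1) hx.2.le
      obtain ⟨v, hv⟩ := Int.eq_ofNat_of_zero_le h0
      rw [hv] at h1
      refine ⟨(⟨i, by omega⟩, ⟨v, ?_⟩), hz, x, hxz, hv⟩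
      exact Nat.lt_succ_of_le (by exact_mod_cast h1))
    (fun _ x y hx hy i hi hxB hyB => hBc _ _ hxB hyB (hx.skewClose hy hi)) hK
  have hcompl := P.measureReal_compl_goodSet_le hμ (N := N) (show L ≤ n + 2 * L by omega)
  set τ := ∑' j, P.lam (j + N)
  have hfrac : ((n + 2 * L : ℕ) : ℝ) / P.π N ≤ (1 + 2 * L) / n := by
    have h1 : (n : ℝ) ^ 2 ≤ P.π N := by exact_mod_cast hn1
    calc ((n + 2 * L : ℕ) : ℝ) / P.π N ≤ (n + 2 * L : ℕ) / (n : ℝ) ^ 2 := by gcongr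
      _ ≤ ((1 + 2 * L) * n) / (n : ℝ) ^ 2 := by
          push_cast
          gcongr
          nlinarith [(L.cast_nonneg : (0 : ℝ) ≤ L)]
      _ = _ := by field_simp
  have hcard : Real.log (Fintype.card (Fin (P.π N) × Fin (n * (L + 1) + 1)))
      ≤ 3 * Real.log 2 + 3 * Real.log n + Real.log (L + 1) := by
    have h2 : (P.π N : ℝ) ≤ (2 * n) ^ 2 := by
      have : (P.π N : ℝ) ≤ (n + 1) ^ 2 := by exact_mod_cast hn2
      exact this.trans (by gcongr; linarith)
    have h3 : (n * (L + 1) + 1 : ℝ) ≤ 2 * n * (L + 1) := by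
      nlinarith [(L.cast_nonneg : (0 : ℝ) ≤ L)]
    calc _ = Real.log (P.π N * (n * (L + 1) + 1)) := by simp
      _ ≤ Real.log ((2 * n) ^ 2 * (2 * n * (L + 1))) :=
          Real.log_le_log (by positivity) (by gcongr)
      _ = _ := by
          rw [Real.log_mul (by positivity) (by positivity), Real.log_pow,
            Real.log_mul (x := 2 * (n : ℝ)) (by positivity) (by positivity),
            Real.log_mul (by norm_num) hn0.ne']
          push_cast
          ring
  have hgood : n * Real.log m * μ.real (P.goodSet N (n + 2 * L) L)ᶜ
      ≤ n * Real.log m * ((1 + 2 * L) / n + τ) := by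
    gcongr
    linarith
  rw [div_le_iff₀ hn0]
  calc _ ≤ Real.log 2 + (3 * Real.log 2 + 3 * Real.log n + Real.log (L + 1))
        + n * (m * Real.exp (-K)) + n * (K * μ.real B)
        + n * Real.log m * ((1 + 2 * L) / n + τ) := by linarith
    _ = _ := by
        field_simp
        ring

end RepetitivePattern

/-- A `T`-invariant probability measure with periodic repetitive pattern
has zero Kolmogorov–Sinai entropy. -/
theorem entropy_zero_of_periodicRepetitivePattern
    {k : ℕ} (S : SkewSetup k) (μ : Measure (SkewM k))
    (hprob : IsProbabilityMeasure μ)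
    (hinv : MeasurePreserving S.T μ μ)
    (hpat : HasPeriodicRepetitivePattern S μ) :
    ksEntropy S.T μ = 0 := by
  obtain ⟨P, hP⟩ := hpat
  refine le_antisymm (iSup_le fun m => iSup_le fun ⟨c, hc⟩ => ?_) zero_le
  refine le_of_forall_gt fun a ha => ?_
  obtain ⟨η, -, hη0, hηa⟩ := ENNReal.lt_iff_exists_real_btwn.1 ha
  replace hη0 : 0 < η := ENNReal.ofReal_pos.1 hη0
  obtain ⟨K, hK0, hK⟩ : ∃ K : ℝ, 0 < K ∧ m * Real.exp (-K) < η / 4 := by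
    have h : Tendsto (fun K : ℝ => m * Real.exp (-K)) atTop (nhds (m * 0)) :=
      Real.tendsto_exp_neg_atTop_nhds_zero.const_mul _
    rw [mul_zero] at h
    exact ((eventually_gt_atTop 0).and (h.eventually_lt_const (by linarith))).exists
  obtain ⟨B, L, hB, hBδ, hBc⟩ := exists_skewClose_eq μ hc (δ := η / (4 * K)) (by positivity)
  have hKB : K * μ.real B ≤ η / 4 := by
    calc _ ≤ K * (η / (4 * K)) := by gcongr
      _ = _ := by field_simp
  set C := 4 * Real.log 2 + Real.log (L + 1) + Real.log m * (1 + 2 * L)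
  have hsqrt : Tendsto (fun N => (P.π N).sqrt) atTop atTop := by
    refine tendsto_atTop.2 fun b => ?_
    filter_upwards [eventually_ge_atTop (b * b)] with N hN
    exact Nat.le_sqrt.2 (hN.trans (P.le_π N))
  have hcast := (tendsto_natCast_atTop_atTop (R := ℝ)).comp hsqrt
  have hlim : Tendsto (fun N => C / ((P.π N).sqrt : ℝ)
      + 3 * (Real.log (P.π N).sqrt / (P.π N).sqrt) + Real.log m * ∑' j, P.lam (j + N))
      atTop (nhds (0 + 3 * 0 + Real.log m * 0)) :=
    ((hcast.const_div_atTop C).add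
      ((Real.isLittleO_log_id_atTop.tendsto_div_nhds_zero.comp hcast).const_mul 3)).add
      ((tendsto_sum_nat_add P.lam).const_mul _)
  simp only [mul_zero, add_zero] at hlim
  obtain ⟨N, hN⟩ := (hlim.eventually_lt_const (show 0 < η / 2 by linarith)).exists
  have hr : 0 < (P.π N).sqrt := Nat.sqrt_pos.2 (P.π_pos N)
  have hbound := P.itinerary_entropy_div_le hinv hP hc hB hBc hK0.le hr (Nat.sqrt_le' _)
    (Nat.succ_le_succ_sqrt' _ |>.trans' (Nat.le_succ _))
  obtain ⟨n, hn⟩ := Nat.exists_eq_succ_of_ne_zero hr.ne'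
  refine lt_of_le_of_lt ((iInf_le _ n).trans (ENNReal.ofReal_le_ofReal ?_)) hηa
  rw [hn] at hbound hN
  push_cast at hbound hN
  linarith

end
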